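/- arXiv:2309.05149 — 2 statements merged into one kernel-verified Lean document; each statement's English description precedes it below -/
import Mathlib

section
/- Let p ∈ (1/4, 1) be a real number, let n and m be integers with 1 ≤ m ≤ n, and let t be a non-negative integer with |t − log_p(m/n)| ≤ 1/2 and t + 1 ≤ n. Then for every subset f of [n] with |f| = t + 1, the probability under G(n,p) that f is a face of N_m(G) (i.e., that f has at least m common neighbors) is at most exp(−2(1 − √p)² · m²/n). -/
open MeasureTheory

/-- Configuration of edge indicators for a graph on vertex set `Fin n`. -/
abbrev EdgeCfg (n : ℕ) := {e : Sym2 (Fin n) // ¬ e.IsDiag} → Bool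

/-- Bernoulli measure on `Bool` with success probability `p`. -/
noncomputable def bern (p : ℝ) : Measure Bool :=
  ENNReal.ofReal p • Measure.dirac true + ENNReal.ofReal (1 - p) • Measure.dirac false

/-- The Erdős–Rényi measure `G(n,p)`: edge indicators are i.i.d. Bernoulli(p). -/
noncomputable def erdosRenyi (n : ℕ) (p : ℝ) : Measure (EdgeCfg n) :=
  Measure.pi fun _ => bern p

/-- `u` and `v` are adjacent in the graph encoded by `ω`. -/
def Adj {n : ℕ} (ω : EdgeCfg n) (u v : Fin n) : Prop :=
  ∃ h : u ≠ v, ω ⟨s(u, v), by simpa [Sym2.mk_isDiag_iff] using h⟩ = true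

open Classical in
/-- The set of common neighbors of `S`. -/
noncomputable def commonNbrs {n : ℕ} (ω : EdgeCfg n) (S : Finset (Fin n)) : Finset (Fin n) :=
  Finset.univ.filter fun v => v ∉ S ∧ ∀ u ∈ S, Adj ω v u

/-- `S` is a face of the `m`-neighbor complex of the graph encoded by `ω`. -/
def IsFace {n : ℕ} (ω : EdgeCfg n) (m : ℕ) (S : Finset (Fin n)) : Prop :=
  m ≤ (commonNbrs ω S).card

open ProbabilityTheory

lemma bern_apply_true {p : ℝ} : bern p {true} = ENNReal.ofReal p := by
  simp [bern]

lemma isProbabilityMeasure_bern {p : ℝ} (h0 : 0 ≤ p) (h1 : p ≤ 1) :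
    IsProbabilityMeasure (bern p) := by
  constructor
  simp [bern, ← ENNReal.ofReal_add h0 (sub_nonneg.2 h1)]

lemma isProbabilityMeasure_erdosRenyi (n : ℕ) {p : ℝ} (h0 : 0 ≤ p) (h1 : p ≤ 1) :
    IsProbabilityMeasure (erdosRenyi n p) := by
  have := isProbabilityMeasure_bern h0 h1
  unfold erdosRenyi
  infer_instance

/-- The event that all edges of `S` are present. -/
def allPresent {n : ℕ} (S : Finset {e : Sym2 (Fin n) // ¬ e.IsDiag}) : Set (EdgeCfg n) :=
  {ω | ∀ e ∈ S, ω e = true}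

lemma erdosRenyi_allPresent {n : ℕ} {p : ℝ} (h0 : 0 ≤ p) (h1 : p ≤ 1)
    (S : Finset {e : Sym2 (Fin n) // ¬ e.IsDiag}) :
    erdosRenyi n p (allPresent S) = ENNReal.ofReal p ^ S.card := by
  classical
  have := isProbabilityMeasure_bern h0 h1
  have h : allPresent S = Set.univ.pi fun e => if e ∈ S then {true} else Set.univ := by
    ext ω
    simp only [allPresent, Set.mem_ofPred_eq, Set.mem_pi, Set.mem_univ, true_implies]
    refine forall_congr' fun e => ?_
    by_cases he : e ∈ S <;> simp [he]
  rw [h, erdosRenyi, Measure.pi_pi]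
  simp only [apply_ite (bern p), bern_apply_true, measure_univ]
  rw [Finset.prod_ite_mem, Finset.univ_inter, Finset.prod_const]

lemma measurableSet_allPresent {n : ℕ} (S : Finset {e : Sym2 (Fin n) // ¬ e.IsDiag}) :
    MeasurableSet (allPresent S) :=
  (Set.toFinite _).measurableSet

/-- Presence events of pairwise disjoint edge sets are independent. -/
lemma iIndepSet_allPresent {n : ℕ} {p : ℝ} (h0 : 0 ≤ p) (h1 : p ≤ 1) {ι : Type*}
    (B : ι → Finset {e : Sym2 (Fin n) // ¬ e.IsDiag})
    (hB : Pairwise fun i j => Disjoint (B i) (B j)) :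
    iIndepSet (fun i => allPresent (B i)) (erdosRenyi n p) := by
  classical
  have := isProbabilityMeasure_erdosRenyi n h0 h1
  rw [iIndepSet_iff_meas_biInter fun i => measurableSet_allPresent (B i)]
  intro s
  have h : ⋂ i ∈ s, allPresent (B i) = allPresent (s.biUnion B) := by
    ext ω
    simp only [allPresent, Set.mem_iInter, Set.mem_ofPred_eq, Finset.mem_biUnion]
    exact ⟨fun H e ⟨i, hi, he⟩ => H i hi e he, fun H i hi e he => H e ⟨i, hi, he⟩⟩
  simp only [h, erdosRenyi_allPresent h0 h1]
  rw [Finset.card_biUnion fun i _ j _ hij => hB hij, Finset.prod_pow_eq_pow_sum]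

/-- **Hoeffding's inequality** for the number of occurring events in an independent family. -/
lemma measureReal_le_card_indicator {Ω : Type*} [MeasurableSpace Ω] {μ : Measure Ω}
    [IsProbabilityMeasure μ] {ι : Type*} [Fintype ι] {A : ι → Set Ω}
    (hA : ∀ i, MeasurableSet (A i)) (hind : iIndepSet A μ) {ε : ℝ} (hε : 0 ≤ ε) :
    μ.real {ω | ε ≤ ∑ i, ((A i).indicator (fun _ => (1 : ℝ)) ω - μ.real (A i))} ≤
      Real.exp (-(2 * ε ^ 2 / Fintype.card ι)) := by
  have hX : iIndepFun (fun i ω => (A i).indicator (fun _ => (1 : ℝ)) ω - μ.real (A i)) μ :=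
    (hind.iIndepFun_indicator (β := ℝ)).comp (fun i x => x - μ.real (A i))
      fun i => measurable_id.sub_const _
  have hsub (i : ι) : HasSubgaussianMGF
      (fun ω => (A i).indicator (fun _ => (1 : ℝ)) ω - μ.real (A i))
      ((‖(1 : ℝ) - 0‖₊ / 2) ^ 2) μ := by
    have hint : ∫ ω, (A i).indicator (fun _ => (1 : ℝ)) ω ∂μ = μ.real (A i) :=
      integral_indicator_one (hA i)
    rw [← hint]
    refine hasSubgaussianMGF_of_mem_Icc
      (measurable_const.indicator (hA i)).aemeasurable (Filter.Eventually.of_forall fun ω => ?_)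
    by_cases hω : ω ∈ A i <;> simp [hω]
  refine (HasSubgaussianMGF.measure_sum_ge_le_of_iIndepFun hX
    (s := Finset.univ) (fun i _ => hsub i) hε).trans_eq ?_
  congr 1
  simp only [sub_zero, nnnorm_one, Finset.sum_const, Finset.card_univ, nsmul_eq_mul]
  push_cast
  rw [show (2 : ℝ) * (Fintype.card ι * (1 / 2) ^ 2) = Fintype.card ι / 2 by ring,
    div_div_eq_mul_div]
  ring

open Classical in
/-- The edges joining `v` to `f`. -/
noncomputable def edgesTo {n : ℕ} (f : Finset (Fin n)) (v : Fin n) :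
    Finset {e : Sym2 (Fin n) // ¬ e.IsDiag} :=
  Finset.univ.filter fun e => ∃ u ∈ f, e.1 = s(v, u)

lemma mem_edgesTo {n : ℕ} {f : Finset (Fin n)} {v : Fin n}
    {e : {e : Sym2 (Fin n) // ¬ e.IsDiag}} : e ∈ edgesTo f v ↔ ∃ u ∈ f, e.1 = s(v, u) := by
  simp [edgesTo]

lemma card_edgesTo {n : ℕ} {f : Finset (Fin n)} {v : Fin n} (hv : v ∉ f) :
    (edgesTo f v).card = f.card := by
  classical
  have h : (edgesTo f v).map (Function.Embedding.subtype _) = f.image fun u => s(v, u) := by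
    ext e
    simp only [Finset.mem_map, Function.Embedding.subtype_apply, Finset.mem_image, mem_edgesTo]
    constructor
    · rintro ⟨e, ⟨u, hu, he⟩, rfl⟩
      exact ⟨u, hu, he.symm⟩
    · rintro ⟨u, hu, rfl⟩
      refine ⟨⟨s(v, u), ?_⟩, ⟨u, hu, rfl⟩, rfl⟩
      rw [Sym2.mk_isDiag_iff]
      rintro rfl
      exact hv hu
  rw [← Finset.card_map (Function.Embedding.subtype _), h, Finset.card_image_of_injective]
  intro a b hab
  exact Sym2.congr_right.1 hab

lemma disjoint_edgesTo {n : ℕ} {f : Finset (Fin n)} {v w : Fin n} (hv : v ∉ f) (hvw : v ≠ w) :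
    Disjoint (edgesTo f v) (edgesTo f w) := by
  rw [Finset.disjoint_left]
  intro e he he'
  obtain ⟨u, hu, h⟩ := mem_edgesTo.1 he
  obtain ⟨u', hu', h'⟩ := mem_edgesTo.1 he'
  rw [h, Sym2.eq_iff] at h'
  rcases h' with ⟨h1, -⟩ | ⟨h1, -⟩
  · exact hvw h1
  · exact hv (h1 ▸ hu')

lemma forall_adj_iff_mem_allPresent {n : ℕ} {f : Finset (Fin n)} {v : Fin n} (hv : v ∉ f)
    (ω : EdgeCfg n) : (∀ u ∈ f, Adj ω v u) ↔ ω ∈ allPresent (edgesTo f v) := by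
  constructor
  · rintro H ⟨e, hd⟩ he
    obtain ⟨u, hu, rfl⟩ := mem_edgesTo.1 he
    exact (H u hu).2
  · intro H u hu
    exact ⟨fun h => hv (h ▸ hu), H _ (mem_edgesTo.2 ⟨u, hu, rfl⟩)⟩

lemma card_commonNbrs {n : ℕ} (f : Finset (Fin n)) (ω : EdgeCfg n) :
    ((commonNbrs ω f).card : ℝ) =
      ∑ v : {v // v ∉ f}, (allPresent (edgesTo f v.1)).indicator (fun _ => (1 : ℝ)) ω := by
  classical
  have h : commonNbrs ω f = (Finset.univ.filter fun v : {v // v ∉ f} =>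
      ω ∈ allPresent (edgesTo f v.1)).map (Function.Embedding.subtype _) := by
    ext v
    by_cases hv : v ∈ f <;> simp [commonNbrs, hv, forall_adj_iff_mem_allPresent]
  simp [h, Set.indicator_apply]

lemma pow_succ_mul_le {p : ℝ} (hp0 : 0 < p) (hp1 : p < 1) {n m : ℝ} {t : ℕ}
    (hn : 0 < n) (hm : 0 < m)
    (ht : -(1 / 2) ≤ (t : ℝ) - (Real.log m - Real.log n) / Real.log p) :
    n * p ^ (t + 1) ≤ Real.sqrt p * m := by
  have hlog : Real.log p < 0 := Real.log_neg hp0 hp1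
  have hs : 0 < Real.sqrt p := Real.sqrt_pos.2 hp0
  rw [← Real.log_le_log_iff (by positivity) (by positivity), Real.log_mul hn.ne' (by positivity),
    Real.log_mul hs.ne' hm.ne', Real.log_pow, Real.log_sqrt hp0.le]
  have h : (t : ℝ) * Real.log p ≤
      ((Real.log m - Real.log n) / Real.log p - 1 / 2) * Real.log p :=
    mul_le_mul_of_nonpos_right (by linarith) hlog.le
  rw [sub_mul, div_mul_cancel₀ _ hlog.ne] at h
  push_cast
  linarith

/-- Lemma 1 of the paper, case $p > 1/4$: if $|t - \log_p(m/n)| \le 1/2$ and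
$t+1\le n$, then any set of $t+1$ vertices is a face of $N_m(G(n,p))$ with
probability at most $\exp(-2(1-\sqrt p)^2 m^2/n)$. -/
theorem stmt1 (p : ℝ) (hp0 : 1/4 < p) (hp1 : p < 1)
    (n m t : ℕ) (hm1 : 1 ≤ m) (hmn : m ≤ n)
    (ht : |(t : ℝ) - (Real.log m - Real.log n) / Real.log p| ≤ 1/2)
    (htn : t + 1 ≤ n)
    (f : Finset (Fin n)) (hf : f.card = t + 1) :
    erdosRenyi n p {ω | IsFace ω m f} ≤
      ENNReal.ofReal (Real.exp (-(2 * (1 - Real.sqrt p)^2 * (m : ℝ)^2 / n))) := by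
  have h0 : 0 < p := by linarith
  have := isProbabilityMeasure_erdosRenyi n h0.le hp1.le
  have hm : (0 : ℝ) < m := by exact_mod_cast hm1
  have hn : (0 : ℝ) < n := by exact_mod_cast hm1.trans hmn
  have hs : Real.sqrt p < 1 := (Real.sqrt_lt' one_pos).2 (by simpa using hp1)
  have hN : (Fintype.card {v // v ∉ f} : ℝ) ≤ n := by
    exact_mod_cast (Fintype.card_subtype_le _).trans_eq (Fintype.card_fin n)
  have hprob (v : {v // v ∉ f}) :
      (erdosRenyi n p).real (allPresent (edgesTo f v.1)) = p ^ (t + 1) := by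
    rw [measureReal_def, erdosRenyi_allPresent h0.le hp1.le, card_edgesTo v.2, hf,
      ENNReal.toReal_pow, ENNReal.toReal_ofReal h0.le]
  rw [← ofReal_measureReal]
  refine ENNReal.ofReal_le_ofReal ?_
  rcases isEmpty_or_nonempty {v // v ∉ f} with hE | hE
  · have h : {ω : EdgeCfg n | IsFace ω m f} = ∅ := by
      refine Set.eq_empty_of_forall_notMem fun ω hω => hm.not_ge ?_
      have h1 : (m : ℝ) ≤ (commonNbrs ω f).card := Nat.cast_le.2 hω
      simpa [card_commonNbrs] using h1
    rw [h, measureReal_empty]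
    positivity
  · have hN0 : (0 : ℝ) < Fintype.card {v // v ∉ f} := Nat.cast_pos.2 Fintype.card_pos
    have hε : 0 ≤ (1 - Real.sqrt p) * m := mul_nonneg (by linarith) hm.le
    have hmean : (Fintype.card {v // v ∉ f} : ℝ) * p ^ (t + 1) ≤ Real.sqrt p * m :=
      (mul_le_mul_of_nonneg_right hN (by positivity)).trans
        (pow_succ_mul_le h0 hp1 hn hm (abs_le.1 ht).1)
    refine (measureReal_mono fun ω hω => ?_).trans
      ((measureReal_le_card_indicator (fun v : {v // v ∉ f} => measurableSet_allPresent _)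
        (iIndepSet_allPresent h0.le hp1.le (fun v : {v // v ∉ f} => edgesTo f v.1)
          fun v w hvw => disjoint_edgesTo v.2 (Subtype.coe_ne_coe.2 hvw)) hε).trans ?_)
    · have h1 : (m : ℝ) ≤ (commonNbrs ω f).card := Nat.cast_le.2 hω
      simp only [Set.mem_ofPred_eq, Finset.sum_sub_distrib, hprob, Finset.sum_const,
        Finset.card_univ, nsmul_eq_mul, ← card_commonNbrs]
      linarith
    · rw [mul_pow, ← mul_assoc]
      gcongr
end

section
/- Let k and m be positive integers with k² + k < m, let β be a real number with k < β < m(k+1)/(m+k+1), and for each n let p_n = n^{−1/β}. Then the probability under G(n, p_n) that simultaneously (i) every k-element subset of [n] has at least m common neighbors and (ii) no (k+1)-element subset of [n] has at least m common neighbors tends to 1 as n → ∞. (Thus the m-neighbor complex is asymptotically almost surely exactly the complex on [n] whose faces are all sets of at most k vertices.) -/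
open MeasureTheory

lemma isProbabilityMeasure_bern_s18 {p : ℝ} (hp0 : 0 ≤ p) (hp1 : p ≤ 1) :
    IsProbabilityMeasure (bern p) := by
  constructor
  simp [bern, ← ENNReal.ofReal_add hp0 (sub_nonneg.2 hp1)]

lemma pi_bern_forall_true {ι : Type*} [Fintype ι] {p : ℝ} (hp0 : 0 ≤ p) (hp1 : p ≤ 1)
    (E : Finset ι) :
    Measure.pi (fun _ : ι => bern p) {ω | ∀ e ∈ E, ω e = true} = ENNReal.ofReal p ^ E.card := by
  classical
  have := isProbabilityMeasure_bern_s18 hp0 hp1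
  have hset : {ω : ι → Bool | ∀ e ∈ E, ω e = true} =
      Set.pi Set.univ (fun e => if e ∈ E then {true} else Set.univ) := by
    ext ω
    simp only [Set.mem_ofPred_eq, Set.mem_pi, Set.mem_univ, forall_true_left]
    refine forall_congr' fun e => ?_
    split_ifs with h <;> simp [h]
  have hval : ∀ e : ι, bern p (if e ∈ E then {true} else Set.univ) =
      if e ∈ E then ENNReal.ofReal p else 1 := by
    intro e
    split_ifs
    · simp [bern]
    · exact measure_univ
  rw [hset, Measure.pi_pi, Finset.prod_congr rfl fun e _ => hval e]
  simp

lemma pi_bern_forall_not_forall_true {ι V : Type*} [Fintype ι] {p : ℝ} (hp0 : 0 ≤ p)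
    (hp1 : p ≤ 1) (U : Finset V) (E : V → Finset ι)
    (hE : (U : Set V).PairwiseDisjoint E) (k : ℕ) (hk : ∀ v ∈ U, (E v).card = k) :
    Measure.pi (fun _ : ι => bern p) {ω | ∀ v ∈ U, ¬ ∀ e ∈ E v, ω e = true} =
      ENNReal.ofReal (1 - p ^ k) ^ U.card := by
  classical
  have := isProbabilityMeasure_bern_s18 hp0 hp1
  have hind : ProbabilityTheory.iIndepFun (fun (i : ι) (ω : ι → Bool) => ω i)
      (Measure.pi (fun _ : ι => bern p)) :=
    ProbabilityTheory.iIndepFun_pi (X := fun _ b => b) fun _ => aemeasurable_id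
  have hone : ∀ v ∈ U, Measure.pi (fun _ : ι => bern p) {ω | ¬ ∀ e ∈ E v, ω e = true} =
      ENNReal.ofReal (1 - p ^ k) := by
    intro v hv
    rw [← Set.compl_ofPred, prob_compl_eq_one_sub MeasurableSet.of_discrete,
      pi_bern_forall_true hp0 hp1, hk v hv, ENNReal.ofReal_sub _ (pow_nonneg hp0 k),
      ENNReal.ofReal_one, ENNReal.ofReal_pow hp0]
  clear hk
  induction U using Finset.induction_on with
  | empty => simp
  | insert v U hv ih =>
    have hdisj : Disjoint (E v) (U.biUnion E) := by
      rw [Finset.disjoint_biUnion_right]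
      intro w hw
      exact hE (by simp) (by simp [hw]) fun h => hv (h ▸ hw)
    have hmul := (hind.indepFun_finset _ _ hdisj
      fun i => measurable_pi_apply i).measure_inter_preimage_eq_mul
      {x | ¬ ∀ e, x e = true}
      {x | ∀ w (hw : w ∈ U), ¬ ∀ e (he : e ∈ E w),
        x ⟨e, Finset.mem_biUnion.2 ⟨w, hw, he⟩⟩ = true}
      MeasurableSet.of_discrete MeasurableSet.of_discrete
    rw [Finset.card_insert_of_notMem hv, pow_succ',
      ← ih (hE.subset (by simp)) fun w hw => hone w (Finset.mem_insert_of_mem hw),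
      ← hone v (Finset.mem_insert_self v U)]
    convert hmul using 2
    · ext ω
      simp
    · congr 1
      ext ω
      simp
    · rfl

open Classical in
/-- The edge slots joining a vertex of `T` to a vertex of `S`. -/
noncomputable def crossEdges {n : ℕ} (T S : Finset (Fin n)) :
    Finset {e : Sym2 (Fin n) // ¬ e.IsDiag} :=
  Finset.univ.filter fun e => ∃ v ∈ T, ∃ u ∈ S, e.1 = s(v, u)

lemma card_crossEdges {n : ℕ} {T S : Finset (Fin n)} (h : Disjoint T S) :
    (crossEdges T S).card = T.card * S.card := by
  classical
  rw [← Finset.card_product, ← Finset.card_map (Function.Embedding.subtype _)]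
  have himg : (crossEdges T S).map (Function.Embedding.subtype _) =
      (T ×ˢ S).image fun x => s(x.1, x.2) := by
    ext e
    simp only [crossEdges, Finset.mem_map, Finset.mem_filter, Finset.mem_univ, true_and,
      Function.Embedding.subtype_apply, Finset.mem_image, Finset.mem_product, Prod.exists]
    constructor
    · rintro ⟨e, ⟨v, hv, u, hu, he⟩, rfl⟩
      exact ⟨v, u, ⟨hv, hu⟩, he.symm⟩
    · rintro ⟨v, u, ⟨hv, hu⟩, rfl⟩
      exact ⟨⟨s(v, u), by simpa using Finset.disjoint_iff_ne.1 h v hv u hu⟩,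
        ⟨v, hv, u, hu, rfl⟩, rfl⟩
  rw [himg, Finset.card_image_of_injOn]
  rintro ⟨v, u⟩ hx ⟨v', u'⟩ hy hxy
  simp only [Finset.coe_product, Set.mem_prod, Finset.mem_coe] at hx hy
  rcases Sym2.eq_iff.1 hxy with ⟨h1, h2⟩ | ⟨h1, -⟩
  · exact Prod.ext h1 h2
  · exact absurd h1 (Finset.disjoint_iff_ne.1 h v hx.1 u' hy.2)

lemma forall_crossEdges_iff {n : ℕ} (ω : EdgeCfg n) {T S : Finset (Fin n)}
    (h : Disjoint T S) :
    (∀ e ∈ crossEdges T S, ω e = true) ↔ ∀ v ∈ T, ∀ u ∈ S, Adj ω v u := by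
  simp only [crossEdges, Finset.mem_filter, Finset.mem_univ, true_and]
  constructor
  · intro H v hv u hu
    exact ⟨Finset.disjoint_iff_ne.1 h v hv u hu, H _ ⟨v, hv, u, hu, rfl⟩⟩
  · rintro H ⟨e, he⟩ ⟨v, hv, u, hu, rfl⟩
    exact (H v hv u hu).2

lemma erdosRenyi_forall_adj {n : ℕ} {p : ℝ} (hp0 : 0 ≤ p) (hp1 : p ≤ 1)
    {T S : Finset (Fin n)} (h : Disjoint T S) :
    erdosRenyi n p {ω | ∀ v ∈ T, ∀ u ∈ S, Adj ω v u} =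
      ENNReal.ofReal p ^ (T.card * S.card) := by
  rw [← card_crossEdges h, ← pi_bern_forall_true hp0 hp1, erdosRenyi]
  simp only [forall_crossEdges_iff _ h]

lemma erdosRenyi_forall_not_forall_adj {n : ℕ} {p : ℝ} (hp0 : 0 ≤ p) (hp1 : p ≤ 1)
    {U S : Finset (Fin n)} (h : Disjoint U S) :
    erdosRenyi n p {ω | ∀ v ∈ U, ¬ ∀ u ∈ S, Adj ω v u} =
      ENNReal.ofReal (1 - p ^ S.card) ^ U.card := by
  have hv : ∀ v ∈ U, Disjoint {v} S := fun v hv =>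
    h.mono_left (Finset.singleton_subset_iff.2 hv)
  rw [← pi_bern_forall_not_forall_true hp0 hp1 U (fun v => crossEdges {v} S) ?_ S.card
    fun v hvU => by rw [card_crossEdges (hv v hvU)]; simp, erdosRenyi]
  · congr 1
    ext ω
    refine forall₂_congr fun v hvU => ?_
    rw [forall_crossEdges_iff ω (hv v hvU)]
    simp
  · intro v hvU w hwU hvw
    refine Finset.disjoint_left.2 fun e he he' => hvw ?_
    simp only [crossEdges, Finset.mem_filter, Finset.mem_univ, true_and,
      Finset.mem_singleton, exists_eq_left] at he he'
    obtain ⟨u, hu, he⟩ := he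
    obtain ⟨u', hu', he'⟩ := he'
    rcases Sym2.eq_iff.1 (he.symm.trans he') with ⟨h1, -⟩ | ⟨h1, -⟩
    · exact h1
    · exact absurd h1 (Finset.disjoint_iff_ne.1 h v hvU u' hu')

lemma card_powersetCard_univ_le (n j : ℕ) :
    ((Finset.powersetCard j (Finset.univ : Finset (Fin n))).card : ENNReal) ≤ (n : ENNReal) ^ j := by
  rw [Finset.card_powersetCard, Finset.card_univ, Fintype.card_fin]
  exact_mod_cast Nat.choose_le_pow n j

lemma erdosRenyi_exists_isFace_le {n : ℕ} {p : ℝ} (hp0 : 0 ≤ p) (hp1 : p ≤ 1) (m j : ℕ) :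
    erdosRenyi n p {ω | ∃ S : Finset (Fin n), S.card = j ∧ IsFace ω m S} ≤
      (n : ENNReal) ^ (j + m) * ENNReal.ofReal p ^ (m * j) := by
  classical
  let P := fun i => Finset.powersetCard i (Finset.univ : Finset (Fin n))
  have hsub : {ω : EdgeCfg n | ∃ S : Finset (Fin n), S.card = j ∧ IsFace ω m S} ⊆
      ⋃ x ∈ P j ×ˢ P m, {ω | Disjoint x.2 x.1 ∧ ∀ v ∈ x.2, ∀ u ∈ x.1, Adj ω v u} := by
    rintro ω ⟨S, hS, hF⟩
    obtain ⟨T, hT, hTm⟩ := Finset.exists_subset_card_eq hF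
    have hmem : ∀ v ∈ T, v ∉ S ∧ ∀ u ∈ S, Adj ω v u := fun v hv => by
      simpa [commonNbrs] using hT hv
    simp only [Set.mem_iUnion]
    exact ⟨(S, T), by simp [P, hS, hTm],
      Finset.disjoint_left.2 fun v hv => (hmem v hv).1, fun v hv => (hmem v hv).2⟩
  refine (measure_mono hsub).trans <| (measure_biUnion_finset_le _ _).trans ?_
  refine (Finset.sum_le_card_nsmul _ _ (ENNReal.ofReal p ^ (m * j)) ?_).trans ?_
  · rintro ⟨S, T⟩ hx
    simp only [P, Finset.mem_product, Finset.mem_powersetCard_univ] at hx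
    by_cases hd : Disjoint T S
    · simp only [hd, true_and]
      rw [erdosRenyi_forall_adj hp0 hp1 hd, hx.1, hx.2]
    · simp [hd]
  · rw [Finset.card_product, nsmul_eq_mul, Nat.cast_mul, pow_add]
    gcongr <;> exact card_powersetCard_univ_le _ _

lemma erdosRenyi_exists_not_isFace_le {n : ℕ} {p : ℝ} (hp0 : 0 ≤ p) (hp1 : p ≤ 1)
    (m k : ℕ) (hmn : m ≤ n) :
    erdosRenyi n p {ω | ∃ S : Finset (Fin n), S.card = k ∧ ¬ IsFace ω m S} ≤
      (n : ENNReal) ^ (k + m) * ENNReal.ofReal (1 - p ^ k) ^ (n - (k + m)) := by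
  classical
  let P := fun i => Finset.powersetCard i (Finset.univ : Finset (Fin n))
  have hsub : {ω : EdgeCfg n | ∃ S : Finset (Fin n), S.card = k ∧ ¬ IsFace ω m S} ⊆
      ⋃ x ∈ P k ×ˢ P m, {ω | ∀ v ∈ (x.1 ∪ x.2)ᶜ, ¬ ∀ u ∈ x.1, Adj ω v u} := by
    rintro ω ⟨S, hS, hF⟩
    obtain ⟨T, hT, hTm⟩ := Finset.exists_superset_card_eq (n := m) (not_le.1 hF).le
      (by simpa using hmn)
    simp only [Set.mem_iUnion]
    refine ⟨(S, T), by simp [P, hS, hTm], fun v hv hadj => ?_⟩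
    simp only [Finset.mem_compl, Finset.mem_union, not_or] at hv
    exact hv.2 (hT (by simpa [commonNbrs] using ⟨hv.1, hadj⟩))
  have hle : ENNReal.ofReal (1 - p ^ k) ≤ 1 := by
    rw [ENNReal.ofReal_le_one]
    linarith [pow_nonneg hp0 k]
  refine (measure_mono hsub).trans <| (measure_biUnion_finset_le _ _).trans ?_
  refine (Finset.sum_le_card_nsmul _ _
    (ENNReal.ofReal (1 - p ^ k) ^ (n - (k + m))) ?_).trans ?_
  · rintro ⟨S, T⟩ hx
    simp only [P, Finset.mem_product, Finset.mem_powersetCard_univ] at hx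
    have hd : Disjoint (S ∪ T)ᶜ S :=
      disjoint_compl_left.mono_right Finset.subset_union_left
    rw [erdosRenyi_forall_not_forall_adj hp0 hp1 hd, hx.1]
    refine pow_le_pow_right_of_le_one' hle ?_
    rw [Finset.card_compl, Fintype.card_fin]
    have := Finset.card_union_le S T
    omega
  · rw [Finset.card_product, nsmul_eq_mul, Nat.cast_mul, pow_add]
    gcongr <;> exact card_powersetCard_univ_le _ _

lemma tendsto_pow_mul_rpow_pow {β : ℝ} {a b : ℕ} (h : (a : ℝ) < b / β) :
    Filter.Tendsto (fun n : ℕ => (n : ℝ) ^ a * ((n : ℝ) ^ (-(1 / β))) ^ b)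
      Filter.atTop (nhds 0) := by
  have h0 := (tendsto_rpow_neg_atTop (sub_pos.2 h)).comp tendsto_natCast_atTop_atTop
  refine h0.congr' ?_
  filter_upwards [Filter.eventually_gt_atTop 0] with n hn
  have hn : (0 : ℝ) < n := Nat.cast_pos.2 hn
  rw [← Real.rpow_natCast, ← Real.rpow_natCast, ← Real.rpow_mul hn.le, ← Real.rpow_add hn,
    Function.comp_apply]
  congr 1
  ring

lemma tendsto_pow_mul_one_sub_pow {β : ℝ} {k : ℕ} (hβ : (k : ℝ) < β) (a c : ℕ) :
    Filter.Tendsto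
      (fun n : ℕ => (n : ℝ) ^ a * (1 - ((n : ℝ) ^ (-(1 / β))) ^ k) ^ (n - c))
      Filter.atTop (nhds 0) := by
  have hβ0 : 0 < β := (Nat.cast_nonneg k).trans_lt hβ
  set δ : ℝ := 1 - k / β with hδ
  have hδ0 : 0 < δ := sub_pos.2 ((div_lt_one hβ0).2 hβ)
  have h0 := ((tendsto_rpow_mul_exp_neg_mul_atTop_nhds_zero (a / δ) (1 / 2) (by norm_num)).comp
    (tendsto_rpow_atTop hδ0)).comp tendsto_natCast_atTop_atTop
  have hp1 : ∀ n : ℕ, 0 < n → ((n : ℝ) ^ (-(1 / β))) ^ k ≤ 1 := fun n hn =>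
    pow_le_one₀ (by positivity) <|
      Real.rpow_le_one_of_one_le_of_nonpos (by exact_mod_cast hn) (by simp [hβ0.le])
  refine tendsto_of_tendsto_of_tendsto_of_le_of_le' tendsto_const_nhds h0 ?_ ?_
  · filter_upwards [Filter.eventually_gt_atTop 0] with n hn
    have := sub_nonneg.2 (hp1 n hn)
    positivity
  · filter_upwards [Filter.eventually_gt_atTop 0, Filter.eventually_ge_atTop (2 * c)] with n hn hc
    have hn' : (0 : ℝ) < n := Nat.cast_pos.2 hn
    simp only [Function.comp_apply]
    rw [← Real.rpow_mul hn'.le, mul_div_cancel₀ _ hδ0.ne', Real.rpow_natCast]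
    refine mul_le_mul_of_nonneg_left ?_ (by positivity)
    set q := ((n : ℝ) ^ (-(1 / β))) ^ k with hq
    have hqn : (n : ℝ) ^ δ = q * n := by
      rw [hq, ← Real.rpow_natCast, ← Real.rpow_mul hn'.le, ← Real.rpow_add_one hn'.ne']
      congr 1
      rw [hδ]
      ring
    have hq0 : 0 ≤ q := by positivity
    refine (pow_le_pow_left₀ (sub_nonneg.2 (hp1 n hn)) (Real.one_sub_le_exp_neg q) _).trans ?_
    rw [← Real.exp_nat_mul, Real.exp_le_exp, hqn, Nat.cast_sub (by omega)]
    have hc' : (2 : ℝ) * c ≤ n := by exact_mod_cast hc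
    nlinarith

/-- Corollary 1, second part: if $k^2 + k < m$ and
$k < \beta < m(k+1)/(m+k+1)$, then with $p_n = n^{-1/\beta}$, asymptotically almost
surely every $k$-set of vertices is a face of $N_m(G(n,p_n))$ and no $(k+1)$-set is. -/
theorem stmt18 (k m : ℕ) (hk : 0 < k) (hm : 0 < m) (hkm : k^2 + k < m)
    (β : ℝ) (hβ1 : (k : ℝ) < β) (hβ2 : β < (m : ℝ) * (k + 1) / (m + k + 1)) :
    Filter.Tendsto
      (fun n : ℕ => erdosRenyi n ((n : ℝ) ^ (-(1/β)))
        {ω | (∀ S : Finset (Fin n), S.card = k → IsFace ω m S) ∧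
             (∀ S : Finset (Fin n), S.card = k + 1 → ¬ IsFace ω m S)})
      Filter.atTop (nhds 1) := by
  classical
  have hβ0 : 0 < β := (Nat.cast_nonneg k).trans_lt hβ1
  have hexp : ((k + 1 + m : ℕ) : ℝ) < (m * (k + 1) : ℕ) / β := by
    rw [lt_div_iff₀ (by positivity)] at hβ2
    rw [lt_div_iff₀ hβ0]
    push_cast
    linarith
  have hlim := (tendsto_pow_mul_one_sub_pow hβ1 (k + m) (k + m)).add
    (tendsto_pow_mul_rpow_pow hexp)
  have hlim' := ENNReal.Tendsto.sub (tendsto_const_nhds (x := (1 : ENNReal)))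
    (ENNReal.tendsto_ofReal hlim) (Or.inl ENNReal.one_ne_top)
  simp only [add_zero, ENNReal.ofReal_zero, tsub_zero] at hlim'
  have hp : ∀ n : ℕ, 0 < n → (n : ℝ) ^ (-(1 / β)) ≤ 1 := fun n hn =>
    Real.rpow_le_one_of_one_le_of_nonpos (by exact_mod_cast hn) (by simp [hβ0.le])
  have hprob : ∀ n : ℕ, 0 < n →
      IsProbabilityMeasure (erdosRenyi n ((n : ℝ) ^ (-(1 / β)))) := fun n hn => by
    have := isProbabilityMeasure_bern_s18 (by positivity) (hp n hn)
    unfold erdosRenyi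
    infer_instance
  refine tendsto_of_tendsto_of_tendsto_of_le_of_le' hlim' tendsto_const_nhds ?_ ?_
  · filter_upwards [Filter.eventually_gt_atTop 0, Filter.eventually_ge_atTop m] with n hn hmn
    have := hprob n hn
    set p := (n : ℝ) ^ (-(1 / β)) with hpdef
    have hp0 : 0 ≤ p := by positivity
    have hp1 : p ≤ 1 := hp n hn
    have hq : 0 ≤ 1 - p ^ k := sub_nonneg.2 (pow_le_one₀ hp0 hp1)
    set A := {ω : EdgeCfg n | (∀ S : Finset (Fin n), S.card = k → IsFace ω m S) ∧
      (∀ S : Finset (Fin n), S.card = k + 1 → ¬ IsFace ω m S)}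
    have hsub : Aᶜ ⊆ {ω : EdgeCfg n | ∃ S : Finset (Fin n), S.card = k ∧ ¬ IsFace ω m S} ∪
        {ω | ∃ S : Finset (Fin n), S.card = k + 1 ∧ IsFace ω m S} := by
      intro ω hω
      by_contra hcon
      simp only [Set.mem_union, Set.mem_ofPred_eq, not_or, not_exists, not_and, not_not] at hcon
      exact hω hcon
    have hA : erdosRenyi n p A = 1 - erdosRenyi n p Aᶜ := by
      rw [← prob_compl_eq_one_sub MeasurableSet.of_discrete, compl_compl]
    rw [hA]
    refine tsub_le_tsub_left ((measure_mono hsub).trans <| (measure_union_le _ _).trans ?_) 1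
    rw [ENNReal.ofReal_add (by positivity) (by positivity),
      ENNReal.ofReal_mul (by positivity), ENNReal.ofReal_mul (by positivity),
      ENNReal.ofReal_pow (by positivity), ENNReal.ofReal_pow hq,
      ENNReal.ofReal_pow (by positivity), ENNReal.ofReal_pow hp0, ENNReal.ofReal_natCast]
    exact add_le_add (erdosRenyi_exists_not_isFace_le hp0 hp1 m k hmn)
      (erdosRenyi_exists_isFace_le hp0 hp1 m (k + 1))
  · filter_upwards [Filter.eventually_gt_atTop 0] with n hn
    have := hprob n hn
    exact prob_le_one
end
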